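/- arXiv:1111.6524 — 2 statements merged into one kernel-verified Lean document; each statement's English description precedes it below -/
import Mathlib

section
/- Let φ : ℝ → ℝ be an even Schwartz function whose Fourier transform φ̂ has compact support. Then as R → ∞, (2/log R)·∑_p (log p / p)·φ̂(2·log p / log R) = φ(0)/2 + O(log log R / log R), where the sum is over all primes p. -/
open MeasureTheory Real Complex FourierTransform

/-- The sum of `log p / p` over the primes `p ≤ n`. -/
noncomputable def primeLogSum (n : ℕ) : ℝ :=
  ∑ p ∈ Finset.Ioc 0 n with p.Prime, Real.log p / p

theorem log_factorial_eq_sum_padicValNat (n : ℕ) :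
    Real.log n.factorial =
      ∑ p ∈ Finset.Ioc 0 n with p.Prime, (padicValNat p n.factorial : ℝ) * Real.log p := by
  rw [Real.log_nat_eq_sum_factorization, Finsupp.sum_of_support_subset
    (s := Finset.filter Nat.Prime (Finset.Ioc 0 n)) _ ?_ _ (by simp)]
  · refine Finset.sum_congr rfl fun p hp => ?_
    rw [Nat.factorization_def _ (Finset.mem_filter.1 hp).2]
  · intro p hp
    rw [Nat.support_factorization] at hp
    have hpp := Nat.prime_of_mem_primeFactors hp
    exact Finset.mem_filter.2 ⟨Finset.mem_Ioc.2
      ⟨hpp.pos, hpp.dvd_factorial.1 (Nat.dvd_of_mem_primeFactors hp)⟩, hpp⟩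

theorem primeLogSum_le {n : ℕ} (hn : n ≠ 0) : primeLogSum n ≤ Real.log n + Real.log 4 := by
  have hn' : (0 : ℝ) < n := by positivity
  have hfac : Real.log n.factorial ≤ n * Real.log n := by
    rw [← Real.log_pow]
    exact Real.log_le_log (by positivity) (by exact_mod_cast Nat.factorial_le_pow n)
  have htheta : Chebyshev.theta n ≤ Real.log 4 * n := Chebyshev.theta_le_log4_mul_x hn'.le
  have key : n * primeLogSum n - Chebyshev.theta n ≤ Real.log n.factorial := by
    rw [log_factorial_eq_sum_padicValNat, primeLogSum, Chebyshev.theta, Nat.floor_natCast,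
      Finset.mul_sum, ← Finset.sum_sub_distrib]
    refine Finset.sum_le_sum fun p hp => ?_
    obtain ⟨hp1, hpp⟩ := Finset.mem_filter.1 hp
    have hp0 : (0 : ℝ) < p := by exact_mod_cast hpp.pos
    have hlog : 0 ≤ Real.log p := Real.log_natCast_nonneg p
    have hdiv : (n : ℝ) / p - 1 ≤ padicValNat p n.factorial := by
      have h1 : n / p ≤ padicValNat p n.factorial := by
        have := Fact.mk hpp
        rw [← padicValNat_mul_div_factorial, padicValNat_factorial_mul]
        exact Nat.le_add_left _ _
      have h2 : (n : ℝ) / p < (n / p : ℕ) + 1 := by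
        rw [← Nat.floor_div_eq_div (K := ℝ)]
        exact Nat.lt_floor_add_one _
      have h3 : ((n / p : ℕ) : ℝ) ≤ padicValNat p n.factorial := by exact_mod_cast h1
      linarith
    calc n * (Real.log p / p) - Real.log p = ((n : ℝ) / p - 1) * Real.log p := by ring
      _ ≤ _ := by gcongr
  have : n * primeLogSum n ≤ n * (Real.log n + Real.log 4) := by linarith
  exact le_of_mul_le_mul_left this hn'

theorem summable_log_div_mul_sub_one :
    Summable fun n : ℕ => Real.log n / (n * (n - 1)) := by
  have hs : Summable fun n : ℕ => 4 * (1 / (n : ℝ) ^ (3 / 2 : ℝ)) :=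
    (Real.summable_one_div_nat_rpow.2 (by norm_num)).mul_left 4
  refine hs.of_nonneg_of_le (fun n => ?_) fun n => ?_
  · rcases n with _ | n
    · simp
    · push_cast
      have : 0 ≤ Real.log ((n : ℝ) + 1) := Real.log_nonneg (by linarith [n.cast_nonneg (α := ℝ)])
      rw [add_sub_cancel_right]
      positivity
  · rcases Nat.lt_or_ge n 2 with h | h
    · interval_cases n <;> simp
    · have h2 : (2 : ℝ) ≤ n := by exact_mod_cast h
      have hlog : Real.log n ≤ 2 * (n : ℝ) ^ (1 / 2 : ℝ) := by
        have := Real.log_le_rpow_div (x := n) (ε := 1 / 2) (by positivity) (by norm_num)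
        linarith
      have hsplit : (n : ℝ) ^ (3 / 2 : ℝ) * (n : ℝ) ^ (1 / 2 : ℝ) = n ^ 2 := by
        rw [← Real.rpow_add (by positivity)]
        norm_num
      rw [mul_one_div, div_le_div_iff₀ (by nlinarith) (by positivity)]
      calc Real.log n * (n : ℝ) ^ (3 / 2 : ℝ)
          ≤ 2 * (n : ℝ) ^ (1 / 2 : ℝ) * (n : ℝ) ^ (3 / 2 : ℝ) := by gcongr
        _ = 2 * n ^ 2 := by rw [← hsplit]; ring
        _ ≤ 4 * (n * (n - 1)) := by nlinarith

theorem le_primeLogSum {n : ℕ} (hn : n ≠ 0) :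
    Real.log n - 1 - ∑' m : ℕ, Real.log m / (m * (m - 1)) ≤ primeLogSum n := by
  have hn' : (0 : ℝ) < n := by positivity
  have hn1 : (1 : ℝ) ≤ n := by exact_mod_cast Nat.one_le_iff_ne_zero.2 hn
  have hfac : n * Real.log n - n ≤ Real.log n.factorial := by
    have h1 := Stirling.le_log_factorial_stirling hn
    have h2 : 0 ≤ Real.log n := Real.log_nonneg hn1
    have h3 : 0 ≤ Real.log (2 * π) := Real.log_nonneg (by linarith [Real.two_le_pi])
    linarith
  have htail : ∑ p ∈ Finset.Ioc 0 n with p.Prime, Real.log p / (p * (p - 1)) ≤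
      ∑' m : ℕ, Real.log m / (m * (m - 1)) := by
    refine summable_log_div_mul_sub_one.sum_le_tsum _ fun m _ => ?_
    rcases m with _ | m
    · simp
    · push_cast
      have : 0 ≤ Real.log ((m : ℝ) + 1) := Real.log_nonneg (by linarith [m.cast_nonneg (α := ℝ)])
      rw [add_sub_cancel_right]
      positivity
  have key : Real.log n.factorial ≤
      n * (primeLogSum n + ∑ p ∈ Finset.Ioc 0 n with p.Prime, Real.log p / (p * (p - 1))) := by
    rw [log_factorial_eq_sum_padicValNat, primeLogSum, ← Finset.sum_add_distrib, Finset.mul_sum]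
    refine Finset.sum_le_sum fun p hp => ?_
    obtain ⟨hp1, hpp⟩ := Finset.mem_filter.1 hp
    have hp2 : (2 : ℝ) ≤ p := by exact_mod_cast hpp.two_le
    have hlog : 0 ≤ Real.log p := Real.log_natCast_nonneg p
    have hval : (padicValNat p n.factorial : ℝ) ≤ n / (p - 1) := by
      have := Fact.mk hpp
      have h1 : (p - 1) * padicValNat p n.factorial ≤ n := by
        rw [sub_one_mul_padicValNat_factorial]
        exact Nat.sub_le _ _
      rw [le_div_iff₀ (by linarith), mul_comm]
      have h2 : ((p - 1 : ℕ) : ℝ) * padicValNat p n.factorial ≤ n := by exact_mod_cast h1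
      rwa [Nat.cast_sub hpp.one_le, Nat.cast_one] at h2
    have hp3 : (p : ℝ) - 1 ≠ 0 := by linarith
    calc (padicValNat p n.factorial : ℝ) * Real.log p ≤ n / (p - 1) * Real.log p := by gcongr
      _ = _ := by field_simp; ring
  have : n * (Real.log n - 1 - ∑' m : ℕ, Real.log m / (m * (m - 1))) ≤ n * primeLogSum n := by
    nlinarith
  exact le_of_mul_le_mul_left this hn'

/-- **Mertens' first theorem** for a real variable. -/
theorem exists_abs_primeLogSum_floor_sub_log_le :
    ∃ K : ℝ, 0 ≤ K ∧ ∀ x : ℝ, 1 ≤ x → |primeLogSum ⌊x⌋₊ - Real.log x| ≤ K := by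
  refine ⟨max (Real.log 4) (Real.log 2 + 1 + ∑' m : ℕ, Real.log m / (m * (m - 1))),
    le_max_of_le_left (Real.log_nonneg (by norm_num)), fun x hx => ?_⟩
  have hfl : 1 ≤ ⌊x⌋₊ := Nat.one_le_floor_iff x |>.2 hx
  have hfl' : (1 : ℝ) ≤ ⌊x⌋₊ := by exact_mod_cast hfl
  have h1 := primeLogSum_le (n := ⌊x⌋₊) (by omega)
  have h2 := le_primeLogSum (n := ⌊x⌋₊) (by omega)
  have h3 : Real.log ⌊x⌋₊ ≤ Real.log x :=
    Real.log_le_log (by linarith) (Nat.floor_le (by linarith))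
  have h4 : Real.log x ≤ Real.log 2 + Real.log ⌊x⌋₊ := by
    rw [← Real.log_mul (by norm_num) (by linarith)]
    exact Real.log_le_log (by linarith) (by linarith [Nat.lt_floor_add_one x])
  rw [abs_le]
  constructor
  · linarith [le_max_right (Real.log 4)
      (Real.log 2 + 1 + ∑' m : ℕ, Real.log m / (m * (m - 1)))]
  · linarith [le_max_left (Real.log 4)
      (Real.log 2 + 1 + ∑' m : ℕ, Real.log m / (m * (m - 1)))]

/-- Partial summation: a weighted sum over primes on a logarithmic scale is close to an integral. -/
theorem norm_tsum_primes_sub_integral_le {G G' : ℝ → ℂ} (hG : ∀ u, HasDerivAt G (G' u) u)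
    (hcont : Continuous G') (hsupp : HasCompactSupport G) {K : ℝ}
    (hK : ∀ x : ℝ, 1 ≤ x → |primeLogSum ⌊x⌋₊ - Real.log x| ≤ K) {L : ℝ} (hL : 0 < L) :
    ‖(∑' p : Nat.Primes, ((Real.log p / p : ℝ) : ℂ) * G (2 * Real.log p / L)) -
        (L / 2 : ℝ) * ∫ u in Set.Ioi (0 : ℝ), G u‖ ≤ K * ∫ u in Set.Ioi (0 : ℝ), ‖G' u‖ := by
  have hG'eq : G' = deriv G := funext fun u => (hG u).deriv.symm
  have hsupp' : HasCompactSupport G' := hG'eq ▸ hsupp.deriv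
  have hGcont : Continuous G := continuous_iff_continuousAt.2 fun u => (hG u).continuousAt
  have hint' : Integrable G' := hcont.integrable_of_hasCompactSupport hsupp'
  obtain ⟨U, hU⟩ : ∃ U : ℝ, ∀ u, U < u → G u = 0 ∧ G' u = 0 := by
    obtain ⟨U, hU⟩ := hsupp.isCompact.bddAbove
    refine ⟨U, fun u hu => ⟨?_, ?_⟩⟩
    · exact image_eq_zero_of_notMem_tsupport fun h => absurd (hU h) (not_le.2 hu)
    · refine image_eq_zero_of_notMem_tsupport fun h => absurd (hU ?_) (not_le.2 hu)
      rw [hG'eq] at h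
      exact tsupport_deriv_subset h
  have hGtop : ∀ᶠ u in Filter.atTop, G u = 0 :=
    (Filter.eventually_gt_atTop U).mono fun u hu => (hU u hu).1
  set N : ℕ := ⌊Real.exp (U * L / 2)⌋₊
  set P : Finset ℕ := Finset.filter Nat.Prime (Finset.Ioc 0 N) with hP
  -- reduction to a finite sum
  have hsum : (∑' p : Nat.Primes, ((Real.log p / p : ℝ) : ℂ) * G (2 * Real.log p / L)) =
      ∑ p ∈ P, ((Real.log p / p : ℝ) : ℂ) * G (2 * Real.log p / L) := by
    have h1 := tsum_subtype {p : ℕ | p.Prime}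
      (fun p : ℕ => ((Real.log p / p : ℝ) : ℂ) * G (2 * Real.log p / L))
    refine h1.trans ?_
    rw [tsum_eq_sum (s := Finset.Ioc 0 N), hP, Finset.sum_filter]
    · exact Finset.sum_congr rfl fun p _ => by by_cases hpp : p.Prime <;> simp [hpp]
    · intro p hp
      by_cases hpp : p.Prime
      · have hNp : N < p := by
          by_contra hcon
          exact hp (Finset.mem_Ioc.2 ⟨hpp.pos, not_lt.1 hcon⟩)
        have hp0 : (0 : ℝ) < p := by exact_mod_cast hpp.pos
        have h2 : Real.exp (U * L / 2) < p := (Nat.floor_lt (Real.exp_pos _).le).1 hNp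
        have h3 : U * L / 2 < Real.log p := (Real.lt_log_iff_exp_lt hp0).2 h2
        have h4 : U < 2 * Real.log p / L := by
          rw [lt_div_iff₀ hL]
          linarith
        simp [(hU _ h4).1]
      · simp [Set.indicator, hpp]
  have htail (a : ℝ) : ∫ u in Set.Ici a, G' u = -G a := by
    rw [integral_Ici_eq_integral_Ioi, integral_Ioi_of_hasDerivAt_of_tendsto'
      (fun u _ => hG u) hint'.integrableOn
      (tendsto_const_nhds.congr' (hGtop.mono fun u hu => hu.symm)), zero_sub]
  set B : ℝ → ℝ := fun u => ∑ p ∈ P, if 2 * Real.log p / L ≤ u then Real.log p / p else 0 with hB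
  have hBint : IntegrableOn (fun u => (B u : ℂ) * G' u) (Set.Ioi 0) ∧
      ∫ u in Set.Ioi (0 : ℝ), (B u : ℂ) * G' u =
        -∑ p ∈ P, ((Real.log p / p : ℝ) : ℂ) * G (2 * Real.log p / L) := by
    have hrew : (fun u => (B u : ℂ) * G' u) = fun u => ∑ p ∈ P, ((Real.log p / p : ℝ) : ℂ) *
        (Set.Ici (2 * Real.log p / L)).indicator G' u := by
      funext u
      simp only [hB]
      rw [Complex.ofReal_sum, Finset.sum_mul]
      refine Finset.sum_congr rfl fun p _ => ?_
      by_cases h : 2 * Real.log p / L ≤ u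
      · rw [if_pos h, Set.indicator_of_mem (Set.mem_Ici.2 h)]
      · rw [if_neg h, Set.indicator_of_notMem (by simpa using h)]
        simp
    have hi (p : ℕ) : IntegrableOn (fun u => ((Real.log p / p : ℝ) : ℂ) *
        (Set.Ici (2 * Real.log p / L)).indicator G' u) (Set.Ioi 0) :=
      ((hint'.indicator measurableSet_Ici).const_mul _).integrableOn
    rw [hrew]
    refine ⟨integrable_finsetSum _ fun p _ => hi p, ?_⟩
    rw [integral_finsetSum _ fun p _ => hi p, ← Finset.sum_neg_distrib]
    refine Finset.sum_congr rfl fun p hp => ?_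
    have hlog : 0 < Real.log p :=
      Real.log_pos (by exact_mod_cast (Finset.mem_filter.1 hp).2.one_lt)
    rw [integral_const_mul, setIntegral_indicator measurableSet_Ici,
      Set.inter_eq_right.2 (Set.Ici_subset_Ioi.2 (by positivity)), htail]
    ring
  have hparts : ∫ u in Set.Ioi (0 : ℝ), (u : ℂ) * G' u = -∫ u in Set.Ioi (0 : ℝ), G u := by
    have h := integral_Ioi_mul_deriv_eq_deriv_mul (a := (0 : ℝ)) (u := fun u : ℝ => (u : ℂ))
      (u' := fun _ => 1) (v := G) (v' := G') (a' := 0) (b' := 0)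
      (fun u _ => Complex.ofRealCLM.hasDerivAt) (fun u _ => hG u)
      ((Complex.continuous_ofReal.mul hcont).integrable_of_hasCompactSupport
        hsupp'.mul_left).integrableOn
      ((continuous_const.mul hGcont).integrable_of_hasCompactSupport hsupp.mul_left).integrableOn
      (by
        have : Continuous ((fun u : ℝ => (u : ℂ)) * G) := Complex.continuous_ofReal.mul hGcont
        simpa using (this.tendsto 0).mono_left nhdsWithin_le_nhds)
      (tendsto_const_nhds.congr' (hGtop.mono fun u hu => by simp [hu]))
    simpa using h
  have hBK : ∀ u ∈ Set.Ioi (0 : ℝ), ‖((B u - L / 2 * u : ℝ) : ℂ) * G' u‖ ≤ K * ‖G' u‖ := by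
    intro u hu
    have hu0 : (0 : ℝ) < u := hu
    rcases lt_or_ge U u with h | h
    · simp [(hU u h).2]
    · rw [norm_mul, Complex.norm_real, Real.norm_eq_abs]
      gcongr
      have hBu : B u = primeLogSum ⌊Real.exp (L / 2 * u)⌋₊ := by
        simp only [hB, hP, primeLogSum]
        rw [← Finset.sum_filter, Finset.filter_filter]
        refine Finset.sum_congr ?_ fun _ _ => rfl
        ext p
        simp only [Finset.mem_filter, Finset.mem_Ioc]
        have hiff (hp : p.Prime) : 2 * Real.log p / L ≤ u ↔ p ≤ ⌊Real.exp (L / 2 * u)⌋₊ := by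
          have hp0 : (0 : ℝ) < p := by exact_mod_cast hp.pos
          rw [Nat.le_floor_iff (Real.exp_pos _).le, ← Real.log_le_iff_le_exp hp0, div_le_iff₀ hL]
          constructor <;> intro h <;> linarith
        have hle : ⌊Real.exp (L / 2 * u)⌋₊ ≤ N := by
          refine Nat.floor_le_floor (Real.exp_le_exp.2 ?_)
          nlinarith
        constructor
        · rintro ⟨⟨h0, _⟩, hp, h1⟩
          exact ⟨⟨h0, (hiff hp).1 h1⟩, hp⟩
        · rintro ⟨⟨h0, h1⟩, hp⟩
          exact ⟨⟨h0, h1.trans hle⟩, hp, (hiff hp).2 h1⟩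
      have := hK (Real.exp (L / 2 * u)) (Real.one_le_exp (by positivity))
      rwa [Real.log_exp, ← hBu] at this
  have huint : IntegrableOn (fun u : ℝ => (u : ℂ) * G' u) (Set.Ioi 0) :=
    ((Complex.continuous_ofReal.mul hcont).integrable_of_hasCompactSupport
      hsupp'.mul_left).integrableOn
  have hfinal : (∑ p ∈ P, ((Real.log p / p : ℝ) : ℂ) * G (2 * Real.log p / L)) -
      (L / 2 : ℝ) * ∫ u in Set.Ioi (0 : ℝ), G u =
        -∫ u in Set.Ioi (0 : ℝ), ((B u - L / 2 * u : ℝ) : ℂ) * G' u := by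
    have h : (fun u : ℝ => ((B u - L / 2 * u : ℝ) : ℂ) * G' u) =
        fun u => (B u : ℂ) * G' u - ((L / 2 : ℝ) : ℂ) * ((u : ℂ) * G' u) := by
      funext u
      push_cast
      ring
    rw [h, integral_sub hBint.1 (huint.const_mul _), integral_const_mul, hBint.2, hparts]
    ring
  rw [hsum, hfinal, norm_neg, ← integral_const_mul]
  exact norm_integral_le_of_norm_le (hint'.norm.integrableOn.const_mul K)
    ((ae_restrict_iff' measurableSet_Ioi).2 (Filter.Eventually.of_forall hBK))

theorem integral_Ioi_eq_half_of_even {G : ℝ → ℂ} (hG : Integrable G) (heven : ∀ u, G (-u) = G u) :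
    ∫ u in Set.Ioi (0 : ℝ), G u = (∫ u, G u) / 2 := by
  have h1 : ∫ u in Set.Iic (0 : ℝ), G u = ∫ u in Set.Ioi (0 : ℝ), G u := by
    have := integral_comp_neg_Iic 0 G
    simpa [heven] using this
  have h2 := integral_add_compl (measurableSet_Iic (a := (0 : ℝ))) hG
  rw [Set.compl_Iic, h1] at h2
  rw [← h2]
  ring

theorem fourier_even {f : ℝ → ℂ} (hf : ∀ x, f (-x) = f x) (u : ℝ) : 𝓕 f (-u) = 𝓕 f u := by
  rw [← Real.fourierInv_eq_fourier_neg, Real.fourierInv_eq_fourier_comp_neg]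
  simp only [hf]

theorem stmt12 (φ : SchwartzMap ℝ ℝ) (heven : ∀ x, φ (-x) = φ x)
    (hsupp : HasCompactSupport (𝓕 (fun x : ℝ => (φ x : ℂ)))) :
    ∃ C : ℝ, ∀ R : ℝ, 16 ≤ R →
      ‖(2 / Real.log R : ℂ) *
          (∑' p : Nat.Primes, ((Real.log p / p : ℝ) : ℂ) *
            𝓕 (fun x : ℝ => (φ x : ℂ)) (2 * Real.log p / Real.log R))
        - (φ 0 / 2 : ℝ)‖
        ≤ C * Real.log (Real.log R) / Real.log R := by
  set ψ : SchwartzMap ℝ ℂ := φ.postcompCLM Complex.ofRealCLM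
  have hψφ : (ψ : ℝ → ℂ) = fun x : ℝ => (φ x : ℂ) := rfl
  have hF : 𝓕 (fun x : ℝ => (φ x : ℂ)) = (𝓕 ψ : SchwartzMap ℝ ℂ) := by
    rw [← hψφ, SchwartzMap.fourier_coe]
  have hderiv (u : ℝ) : HasDerivAt (𝓕 (fun x : ℝ => (φ x : ℂ)))
      (SchwartzMap.derivCLM ℂ ℂ (𝓕 ψ) u) u := by
    rw [hF]
    exact (𝓕 ψ).differentiableAt.hasDerivAt
  have htotal : ∫ u, 𝓕 (fun x : ℝ => (φ x : ℂ)) u = φ 0 := by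
    have h : (𝓕⁻ (𝓕 ψ) : SchwartzMap ℝ ℂ) 0 = ψ 0 := by rw [FourierTransform.fourierInv_fourier_eq]
    rw [SchwartzMap.fourierInv_coe, Real.fourierInv_eq] at h
    rw [hF]
    simpa [hψφ] using h
  have hhalf : ∫ u in Set.Ioi (0 : ℝ), 𝓕 (fun x : ℝ => (φ x : ℂ)) u = φ 0 / 2 := by
    rw [integral_Ioi_eq_half_of_even (by rw [hF]; exact (𝓕 ψ).integrable)
      (fourier_even fun x => by rw [heven]), htotal]
  obtain ⟨K, hK0, hK⟩ := exists_abs_primeLogSum_floor_sub_log_le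
  set I : ℝ := ∫ u in Set.Ioi (0 : ℝ), ‖SchwartzMap.derivCLM ℂ ℂ (𝓕 ψ) u‖
  have hI0 : 0 ≤ I := integral_nonneg fun u => norm_nonneg _
  refine ⟨2 * (K * I), fun R hR => ?_⟩
  set L := Real.log R
  have hLe : Real.exp 1 ≤ L := by
    have h1 : Real.log 16 ≤ L := Real.log_le_log (by norm_num) hR
    have h2 : Real.log 16 = 4 * Real.log 2 := by
      rw [show (16 : ℝ) = 2 ^ 4 by norm_num, Real.log_pow]
      norm_num
    linarith [Real.log_two_gt_d9, Real.exp_one_lt_d9]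
  have hL0 : 0 < L := (Real.exp_pos 1).trans_le hLe
  have hloglog : 1 ≤ Real.log L := (Real.le_log_iff_exp_le hL0).2 hLe
  have hmain := norm_tsum_primes_sub_integral_le hderiv
    (SchwartzMap.derivCLM ℂ ℂ (𝓕 ψ)).continuous hsupp hK hL0
  rw [hhalf] at hmain
  have hL0' : (L : ℂ) ≠ 0 := by exact_mod_cast hL0.ne'
  have hrew (S : ℂ) : (2 / L : ℂ) * S - (φ 0 / 2 : ℝ) =
      ((2 / L : ℝ) : ℂ) * (S - (L / 2 : ℝ) * (φ 0 / 2)) := by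
    push_cast
    field_simp
  rw [hrew, norm_mul, Complex.norm_real, Real.norm_of_nonneg (by positivity)]
  calc 2 / L * _ ≤ 2 / L * (K * I) := by gcongr
    _ = 2 * (K * I) * 1 / L := by ring
    _ ≤ 2 * (K * I) * Real.log L / L := by gcongr
end

section
/- Let φ₁, φ₂ be even Schwartz functions whose Fourier transforms are compactly supported. Then as R → ∞, 4·∑_p (log² p)/(p·log² R)·φ̂₁(log p/log R)·φ̂₂(log p/log R) = 2·∫_{−∞}^{∞} |z|·φ̂₁(z)·φ̂₂(z) dz + O(log log R / log R), where the sum is over primes p. -/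
open MeasureTheory Real Complex FourierTransform

theorem contDiff_fourier_ofReal (φ : SchwartzMap ℝ ℝ) :
    ContDiff ℝ 1 (𝓕 (fun x : ℝ => (φ x : ℂ))) := by
  have h := (𝓕 (φ.postcompCLM (𝕜 := ℝ) Complex.ofRealCLM) : SchwartzMap ℝ ℂ).smooth 1
  rw [SchwartzMap.fourier_coe] at h
  exact_mod_cast h

theorem fourier_neg_of_even {f : ℝ → ℂ} (hf : ∀ x, f (-x) = f x) (w : ℝ) :
    𝓕 f (-w) = 𝓕 f w := by
  rw [← Real.fourierInv_eq_fourier_neg, Real.fourierInv_eq_fourier_comp_neg]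
  simp only [hf]

theorem mul_log_sub_le_log_factorial (n : ℕ) (hn : 1 ≤ n) :
    n * Real.log n - n ≤ Real.log (n.factorial) := by
  have hn' : (0 : ℝ) < n := by exact_mod_cast hn
  have h := Real.pow_div_factorial_le_exp (n : ℝ) hn'.le n
  have h2 := Real.log_le_log (by positivity) h
  rw [Real.log_exp, Real.log_div (by positivity) (by positivity), Real.log_pow] at h2
  linarith

theorem log_factorial_le_mul_log (n : ℕ) :
    Real.log (n.factorial) ≤ n * Real.log n := by
  rw [← Real.log_pow]
  exact Real.log_le_log (by positivity) (by exact_mod_cast Nat.factorial_le_pow n)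

theorem log_factorial_eq_sum_primesLE (n : ℕ) :
    Real.log (n.factorial) =
      ∑ p ∈ Nat.primesLE n, (n.factorial.factorization p : ℝ) * Real.log p := by
  rw [Real.log_nat_eq_sum_factorization, Finsupp.sum]
  refine Finset.sum_subset (fun p hp => ?_) (fun p _ hp => ?_)
  · rw [Nat.support_factorization] at hp
    have hp' := Nat.prime_of_mem_primeFactors hp
    exact Nat.mem_primesLE.2
      ⟨(hp'.dvd_factorial).1 (Nat.dvd_of_mem_primeFactors hp), hp'⟩
  · simp [Finsupp.notMem_support_iff.1 hp]

theorem div_le_factorization_factorial {p : ℕ} (hp : p.Prime) (n : ℕ) :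
    n / p ≤ n.factorial.factorization p := by
  have h1 : (p * (n / p)).factorial ∣ n.factorial :=
    Nat.factorial_dvd_factorial (Nat.mul_div_le n p)
  have h2 := (Nat.factorization_le_iff_dvd (Nat.factorial_ne_zero _)
    (Nat.factorial_ne_zero _)).2 h1 p
  rw [Nat.factorization_factorial_mul hp] at h2
  lia

theorem exists_sum_log_div_mul_pred_le :
    ∃ C : ℝ, ∀ n : ℕ, ∑ p ∈ Nat.primesLE n, Real.log p / (p * (p - 1)) ≤ C := by
  have hs : Summable fun n : ℕ => 4 * (1 / (n : ℝ) ^ (3 / 2 : ℝ)) :=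
    (Real.summable_one_div_nat_rpow.2 (by norm_num)).mul_left 4
  refine ⟨∑' n : ℕ, 4 * (1 / (n : ℝ) ^ (3 / 2 : ℝ)), fun n => ?_⟩
  refine le_trans (Finset.sum_le_sum fun p hp => ?_)
    (hs.sum_le_tsum (Nat.primesLE n) fun _ _ => by positivity)
  have h2 : (2 : ℝ) ≤ p := by exact_mod_cast (Nat.mem_primesLE.1 hp).2.two_le
  have hp0 : (0 : ℝ) < p := by linarith
  have h1 := Real.log_le_rpow_div hp0.le (show (0 : ℝ) < 1 / 2 by norm_num)
  have h3 : (p : ℝ) ^ (1 / 2 : ℝ) * (p : ℝ) ^ (3 / 2 : ℝ) = p ^ 2 := by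
    rw [← Real.rpow_add hp0]; norm_num
  have h4 : 0 < (p : ℝ) ^ (3 / 2 : ℝ) := by positivity
  rw [mul_one_div, div_le_div_iff₀ (by nlinarith) h4]
  calc Real.log p * (p : ℝ) ^ (3 / 2 : ℝ)
      ≤ ((p : ℝ) ^ (1 / 2 : ℝ) / (1 / 2)) * (p : ℝ) ^ (3 / 2 : ℝ) := by gcongr
    _ = 2 * p ^ 2 := by rw [← h3]; ring
    _ ≤ 4 * (p * (p - 1)) := by nlinarith

theorem exists_abs_sum_log_div_sub_log_le :
    ∃ C : ℝ, ∀ n : ℕ, 1 ≤ n →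
      |∑ p ∈ Nat.primesLE n, Real.log p / p - Real.log n| ≤ C := by
  obtain ⟨C, hC⟩ := exists_sum_log_div_mul_pred_le
  refine ⟨max (Real.log 4) (1 + C), fun n hn => ?_⟩
  have hn' : (0 : ℝ) < n := by exact_mod_cast hn
  have hfac := log_factorial_eq_sum_primesLE n
  have hlow : n * ∑ p ∈ Nat.primesLE n, Real.log p / p - Chebyshev.theta n
      ≤ Real.log n.factorial := by
    rw [hfac, Chebyshev.theta_eq_sum_primesLE_log, Finset.mul_sum, ← Finset.sum_sub_distrib]
    refine Finset.sum_le_sum fun p hp => ?_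
    have hpp := (Nat.mem_primesLE.1 hp).2
    have hlog : 0 ≤ Real.log p := Real.log_natCast_nonneg p
    have h1 : (n : ℝ) / p - 1 ≤ n.factorial.factorization p := by
      have h2 := Nat.lt_floor_add_one ((n : ℝ) / p)
      rw [Nat.floor_div_eq_div] at h2
      have h3 : ((n / p : ℕ) : ℝ) ≤ n.factorial.factorization p := by
        exact_mod_cast div_le_factorization_factorial hpp n
      linarith
    calc n * (Real.log p / p) - Real.log p = ((n : ℝ) / p - 1) * Real.log p := by ring
      _ ≤ _ := by gcongr
  have hupp : Real.log n.factorial ≤ n * ∑ p ∈ Nat.primesLE n, Real.log p / p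
      + n * ∑ p ∈ Nat.primesLE n, Real.log p / (p * (p - 1)) := by
    rw [hfac, Finset.mul_sum, Finset.mul_sum, ← Finset.sum_add_distrib]
    refine Finset.sum_le_sum fun p hp => ?_
    have hpp := (Nat.mem_primesLE.1 hp).2
    have hlog : 0 ≤ Real.log p := Real.log_natCast_nonneg p
    have h2 : (2 : ℝ) ≤ p := by exact_mod_cast hpp.two_le
    have h1 : (n.factorial.factorization p : ℝ) ≤ n / (p - 1) := by
      refine (Nat.cast_le.2 (Nat.factorization_factorial_le_div_pred hpp n)).trans ?_
      refine Nat.cast_div_le.trans ?_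
      rw [Nat.cast_sub hpp.one_le, Nat.cast_one]
    calc _ ≤ n / (p - 1) * Real.log p := by gcongr
      _ = _ := by
        have : (p : ℝ) - 1 ≠ 0 := by linarith
        have : (p : ℝ) ≠ 0 := by linarith
        field_simp
        ring
  have hθ := Chebyshev.theta_le_log4_mul_x hn'.le
  have h1 := mul_log_sub_le_log_factorial n hn
  have h2 := log_factorial_le_mul_log n
  have h3 := mul_le_mul_of_nonneg_left (hC n) hn'.le
  rw [abs_le]
  constructor
  · have := le_max_right (Real.log 4) (1 + C)
    refine le_of_mul_le_mul_left ?_ hn'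
    have := mul_le_mul_of_nonneg_left this hn'.le
    linarith
  · refine le_trans ?_ (le_max_left _ _)
    refine le_of_mul_le_mul_left ?_ hn'
    linarith

theorem exists_abs_sum_log_div_floor_exp_sub_le :
    ∃ C : ℝ, ∀ t : ℝ, 0 ≤ t →
      |∑ p ∈ Nat.primesLE ⌊Real.exp t⌋₊, Real.log p / p - t| ≤ C := by
  obtain ⟨C, hC⟩ := exists_abs_sum_log_div_sub_log_le
  refine ⟨C + Real.log 2, fun t ht => ?_⟩
  have hfl : 1 ≤ ⌊Real.exp t⌋₊ := Nat.one_le_floor_iff _ |>.2 (Real.one_le_exp ht)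
  have hfl' : (1 : ℝ) ≤ ⌊Real.exp t⌋₊ := by exact_mod_cast hfl
  have h1 := Real.log_le_log (by positivity) (Nat.floor_le (Real.exp_pos t).le)
  have h2 : t ≤ Real.log (2 * ⌊Real.exp t⌋₊) := by
    rw [Real.le_log_iff_exp_le (by positivity)]
    linarith [Nat.lt_floor_add_one (Real.exp t)]
  rw [Real.log_exp] at h1
  rw [Real.log_mul (by norm_num) (by positivity)] at h2
  have h3 := abs_le.1 (hC _ hfl)
  have := Real.log_nonneg (show (1 : ℝ) ≤ 2 by norm_num)
  rw [abs_le]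
  constructor <;> linarith

theorem eq_neg_setIntegral_indicator_deriv {G : ℝ → ℂ} (hG : ContDiff ℝ 1 G) {a B : ℝ}
    (ha : 0 < a) (haB : a ≤ B) (hB : G B = 0) :
    G a = -∫ t in Set.Ioc 0 B, (Set.Ici a).indicator (deriv G) t := by
  have hset : Set.Ioc 0 B ∩ Set.Ici a = Set.Icc a B := by
    ext t
    simp only [Set.mem_inter_iff, Set.mem_Ioc, Set.mem_Ici, Set.mem_Icc]
    constructor
    · rintro ⟨⟨_, h⟩, h'⟩
      exact ⟨h', h⟩
    · rintro ⟨h, h'⟩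
      exact ⟨⟨by linarith, h'⟩, h⟩
  rw [setIntegral_indicator measurableSet_Ici, hset, integral_Icc_eq_integral_Ioc,
    ← intervalIntegral.integral_of_le haB,
    intervalIntegral.integral_deriv_eq_sub (fun t _ => hG.differentiable (by norm_num) t)
      ((hG.continuous_deriv le_rfl).intervalIntegrable _ _), hB]
  simp

theorem sum_primesLE_mul_eq_neg_setIntegral {G : ℝ → ℂ} (hG : ContDiff ℝ 1 G) {B : ℝ}
    (hB : G B = 0) :
    ∑ p ∈ Nat.primesLE ⌊Real.exp B⌋₊, ((Real.log p / p : ℝ) : ℂ) * G (Real.log p) =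
      -∫ t in Set.Ioc 0 B,
        ((∑ p ∈ Nat.primesLE ⌊Real.exp t⌋₊, Real.log p / p : ℝ) : ℂ) * deriv G t := by
  have hint : IntegrableOn (deriv G) (Set.Ioc 0 B) :=
    (hG.continuous_deriv le_rfl).integrableOn_Ioc
  have hterm : ∀ p ∈ Nat.primesLE ⌊Real.exp B⌋₊,
      ((Real.log p / p : ℝ) : ℂ) * G (Real.log p) = -∫ t in Set.Ioc 0 B,
        ((Real.log p / p : ℝ) : ℂ) * (Set.Ici (Real.log p)).indicator (deriv G) t := by
    intro p hp
    obtain ⟨hpB, hpp⟩ := Nat.mem_primesLE.1 hp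
    have hp1 : (1 : ℝ) < p := by exact_mod_cast hpp.one_lt
    have hle : Real.log p ≤ B := by
      rw [Real.log_le_iff_le_exp (by linarith)]
      exact (Nat.le_floor_iff (Real.exp_pos B).le).1 hpB
    rw [eq_neg_setIntegral_indicator_deriv hG (Real.log_pos hp1) hle hB, integral_const_mul]
    ring
  rw [Finset.sum_congr rfl hterm, Finset.sum_neg_distrib, ← integral_finsetSum]
  · congr 1
    refine setIntegral_congr_fun measurableSet_Ioc fun t ht => ?_
    rw [Complex.ofReal_sum, Finset.sum_mul]
    symm
    refine Finset.sum_subset_zero_on_sdiff (fun p hp => ?_) (fun p hp => ?_) (fun p hp => ?_)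
    · obtain ⟨h1, h2⟩ := Nat.mem_primesLE.1 hp
      exact Nat.mem_primesLE.2
        ⟨h1.trans (Nat.floor_le_floor (Real.exp_le_exp.2 ht.2)), h2⟩
    · rw [Finset.mem_sdiff, Nat.mem_primesLE, Nat.mem_primesLE] at hp
      have hnot : ¬ p ≤ ⌊Real.exp t⌋₊ := fun h => hp.2 ⟨h, hp.1.2⟩
      rw [Set.indicator_of_notMem, mul_zero]
      rw [Set.mem_Ici, Real.log_le_iff_le_exp (by exact_mod_cast hp.1.2.pos),
        ← Nat.le_floor_iff (Real.exp_pos t).le]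
      exact hnot
    · obtain ⟨h1, h2⟩ := Nat.mem_primesLE.1 hp
      rw [Set.indicator_of_mem]
      rw [Set.mem_Ici, Real.log_le_iff_le_exp (by exact_mod_cast h2.pos),
        ← Nat.le_floor_iff (Real.exp_pos t).le]
      exact h1
  · exact fun p _ => (hint.indicator measurableSet_Ici).const_mul _

theorem exists_norm_sum_primesLE_sub_integral_le :
    ∃ C : ℝ, ∀ (G : ℝ → ℂ) (B : ℝ), ContDiff ℝ 1 G → 0 ≤ B → G B = 0 →
      ‖∑ p ∈ Nat.primesLE ⌊Real.exp B⌋₊, ((Real.log p / p : ℝ) : ℂ) * G (Real.log p)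
        - ∫ t in (0 : ℝ)..B, G t‖ ≤ C * ∫ t in (0 : ℝ)..B, ‖deriv G t‖ := by
  obtain ⟨C, hC⟩ := exists_abs_sum_log_div_floor_exp_sub_le
  refine ⟨C, fun G B hG hB hGB => ?_⟩
  set M : ℝ → ℝ := fun t => ∑ p ∈ Nat.primesLE ⌊Real.exp t⌋₊, Real.log p / p with hM
  have hG' := hG.continuous_deriv le_rfl
  have hparts : ∫ t in (0 : ℝ)..B, G t = -∫ t in (0 : ℝ)..B, (t : ℂ) * deriv G t := by
    have h := intervalIntegral.integral_mul_deriv_eq_deriv_mul (a := 0) (b := B)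
      (u := fun t : ℝ => (t : ℂ)) (u' := fun _ => 1) (v := G) (v' := deriv G)
      (fun t _ => Complex.ofRealCLM.hasDerivAt)
      (fun t _ => (hG.differentiable (by norm_num) t).hasDerivAt)
      (by simp) (hG'.intervalIntegrable _ _)
    rw [h]
    simp [hGB]
  have hMmono : Monotone M := fun s t hst =>
    Finset.sum_le_sum_of_subset_of_nonneg
      (fun p hp => Nat.mem_primesLE.2
        ⟨(Nat.mem_primesLE.1 hp).1.trans (Nat.floor_le_floor (Real.exp_le_exp.2 hst)),
          (Nat.mem_primesLE.1 hp).2⟩)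
      (fun p _ _ => div_nonneg (Real.log_natCast_nonneg p) (Nat.cast_nonneg p))
  have hMint : IntervalIntegrable (fun t => (M t : ℂ) * deriv G t) volume 0 B :=
    IntervalIntegrable.mul_continuousOn
      ⟨hMmono.intervalIntegrable.1.ofReal, hMmono.intervalIntegrable.2.ofReal⟩ hG'.continuousOn
  rw [sum_primesLE_mul_eq_neg_setIntegral hG hGB, ← intervalIntegral.integral_of_le hB, hparts,
    sub_neg_eq_add, neg_add_eq_sub, ← intervalIntegral.integral_sub
      (Continuous.intervalIntegrable (by fun_prop) _ _) hMint,
    ← intervalIntegral.integral_const_mul]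
  refine intervalIntegral.norm_integral_le_of_norm_le hB (Filter.Eventually.of_forall ?_)
    (Continuous.intervalIntegrable (by fun_prop) _ _)
  intro t ht
  rw [← sub_mul, norm_mul, ← Complex.ofReal_sub, Complex.norm_real, Real.norm_eq_abs, abs_sub_comm]
  exact mul_le_mul_of_nonneg_right (hC t ht.1.le) (norm_nonneg _)

theorem tsum_primes_eq_sum_primesLE {f : ℕ → ℂ} {N : ℕ} (hf : ∀ n, N < n → f n = 0) :
    ∑' p : Nat.Primes, f p = ∑ p ∈ Nat.primesLE N, f p := by
  rw [show ∑' p : Nat.Primes, f p = ∑' n : ℕ, {p | Nat.Prime p}.indicator f n from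
    tsum_subtype {p | Nat.Prime p} f,
    tsum_eq_sum (s := Nat.primesLE N)]
  · exact Finset.sum_congr rfl fun p hp => Set.indicator_of_mem (Nat.mem_primesLE.1 hp).2 f
  · intro n hn
    by_cases hp : n.Prime
    · rw [Set.indicator_of_mem (by exact hp)]
      exact hf n (not_le.1 fun h => hn (Nat.mem_primesLE.2 ⟨h, hp⟩))
    · exact Set.indicator_of_notMem hp f

theorem integral_abs_mul_eq_two_mul {g : ℝ → ℂ} (hg : Continuous g)
    (heven : ∀ x, g (-x) = g x) (hsupp : HasCompactSupport g) {A : ℝ} (hA : 0 ≤ A)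
    (hgA : ∀ x, A ≤ x → g x = 0) :
    ∫ z : ℝ, ((|z| : ℝ) : ℂ) * g z = 2 * ∫ z in (0 : ℝ)..A, (z : ℂ) * g z := by
  have hint : Integrable fun z : ℝ => ((|z| : ℝ) : ℂ) * g z :=
    Continuous.integrable_of_hasCompactSupport (by fun_prop) hsupp.mul_left
  have hneg : ∫ z in Set.Iic (0 : ℝ), ((|z| : ℝ) : ℂ) * g z
      = ∫ z in Set.Ioi (0 : ℝ), ((|z| : ℝ) : ℂ) * g z := by
    have h := integral_comp_neg_Ioi 0 fun z : ℝ => ((|z| : ℝ) : ℂ) * g z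
    simp only [abs_neg, heven, neg_zero] at h
    exact h.symm
  have hpos : ∫ z in Set.Ioi (0 : ℝ), ((|z| : ℝ) : ℂ) * g z
      = ∫ z in (0 : ℝ)..A, (z : ℂ) * g z := by
    rw [intervalIntegral.integral_of_le hA,
      setIntegral_congr_fun (g := fun z : ℝ => (z : ℂ) * g z) measurableSet_Ioi
        fun z hz => by simp [abs_of_pos (Set.mem_Ioi.1 hz)]]
    refine setIntegral_eq_of_subset_of_forall_sdiff_eq_zero measurableSet_Ioi
      Set.Ioc_subset_Ioi_self ?_
    rintro z ⟨hz, hz'⟩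
    rw [hgA z (not_lt.1 fun h => hz' ⟨hz, h.le⟩), mul_zero]
  rw [← intervalIntegral.integral_Iic_add_Ioi hint.integrableOn hint.integrableOn, hneg, hpos,
    two_mul]

theorem exists_norm_tsum_primes_sub_integral_le {g : ℝ → ℂ} (hg : ContDiff ℝ 1 g)
    (heven : ∀ x, g (-x) = g x) (hsupp : HasCompactSupport g) :
    ∃ C : ℝ, ∀ L : ℝ, 0 < L →
      ‖4 * (∑' p : Nat.Primes,
          (((Real.log p) ^ 2 / (p * L ^ 2) : ℝ) : ℂ) * g (Real.log p / L))
        - 2 * ∫ z : ℝ, ((|z| : ℝ) : ℂ) * g z‖ ≤ C / L := by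
  obtain ⟨K, hK⟩ := exists_norm_sum_primesLE_sub_integral_le
  obtain ⟨A, hA, hgA⟩ : ∃ A : ℝ, 0 < A ∧ ∀ x, A ≤ x → g x = 0 := by
    obtain ⟨A, hA, h⟩ := hsupp.exists_pos_le_norm
    exact ⟨A, hA, fun x hx => h x (hx.trans (le_abs_self x))⟩
  set h : ℝ → ℂ := fun z => (z : ℂ) * g z with hh
  have hhdiff : ContDiff ℝ 1 h := Complex.ofRealCLM.contDiff.mul hg
  refine ⟨4 * (K * ∫ z in (0 : ℝ)..A, ‖deriv h z‖), fun L hL => ?_⟩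
  set F : ℝ → ℂ := fun u => (L : ℂ)⁻¹ * h (u / L) with hF
  have hFdiff : ContDiff ℝ 1 F := contDiff_const.mul (hhdiff.comp (contDiff_id.div_const L))
  have hF' : ∀ u, deriv F u = (L : ℂ)⁻¹ * ((L : ℂ)⁻¹ * deriv h (u / L)) := by
    intro u
    have h1 := (hhdiff.differentiable (by norm_num) (u / L)).hasDerivAt.scomp u
      ((hasDerivAt_id u).div_const L)
    have h2 := (h1.const_mul (L : ℂ)⁻¹).deriv
    simpa [hF, Function.comp_def] using h2
  have hbound := hK F (L * A) hFdiff (by positivity)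
    (by simp [hF, hh, mul_div_cancel_left₀ A hL.ne', hgA A le_rfl])
  have hintF : ∫ t in (0 : ℝ)..(L * A), F t = ∫ z in (0 : ℝ)..A, h z := by
    simp only [hF]
    rw [intervalIntegral.integral_const_mul, intervalIntegral.integral_comp_div _ hL.ne',
      zero_div, mul_div_cancel_left₀ A hL.ne', Complex.real_smul, ← mul_assoc,
      inv_mul_cancel₀ (by exact_mod_cast hL.ne'), one_mul]
  have hintF' : ∫ t in (0 : ℝ)..(L * A), ‖deriv F t‖
      = L⁻¹ * ∫ z in (0 : ℝ)..A, ‖deriv h z‖ := by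
    simp only [hF', norm_mul, norm_inv, Complex.norm_real, Real.norm_eq_abs, abs_of_pos hL]
    rw [intervalIntegral.integral_const_mul, intervalIntegral.integral_const_mul,
      intervalIntegral.integral_comp_div (fun z => ‖deriv h z‖) hL.ne',
      zero_div, mul_div_cancel_left₀ A hL.ne', smul_eq_mul]
    field_simp
  have hsum : ∑' p : Nat.Primes, (((Real.log p) ^ 2 / (p * L ^ 2) : ℝ) : ℂ) * g (Real.log p / L)
      = ∑ p ∈ Nat.primesLE ⌊Real.exp (L * A)⌋₊,
        ((Real.log p / p : ℝ) : ℂ) * F (Real.log p) := by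
    rw [tsum_primes_eq_sum_primesLE (N := ⌊Real.exp (L * A)⌋₊)
      (f := fun p : ℕ => (((Real.log p) ^ 2 / (p * L ^ 2) : ℝ) : ℂ) * g (Real.log p / L))]
    · refine Finset.sum_congr rfl fun p _ => ?_
      simp only [hF, hh]
      push_cast
      ring
    · intro n hn
      have h1 := (Nat.floor_lt (Real.exp_pos _).le).1 hn
      have h2 : L * A < Real.log n := (Real.lt_log_iff_exp_lt ((Real.exp_pos _).trans h1)).2 h1
      rw [hgA _ ((le_div_iff₀ hL).2 (by linarith)), mul_zero]
  rw [hintF, hintF'] at hbound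
  rw [hsum, integral_abs_mul_eq_two_mul hg.continuous heven hsupp hA.le hgA, ← mul_assoc,
    show (2 : ℂ) * 2 = 4 by norm_num, ← mul_sub, norm_mul, Complex.norm_ofNat]
  calc _ ≤ 4 * (K * (L⁻¹ * ∫ z in (0 : ℝ)..A, ‖deriv h z‖)) :=
        mul_le_mul_of_nonneg_left hbound (by norm_num)
    _ = _ := by ring

theorem stmt13 (φ₁ φ₂ : SchwartzMap ℝ ℝ)
    (heven₁ : ∀ x, φ₁ (-x) = φ₁ x) (heven₂ : ∀ x, φ₂ (-x) = φ₂ x)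
    (hsupp₁ : HasCompactSupport (𝓕 (fun x : ℝ => (φ₁ x : ℂ))))
    (hsupp₂ : HasCompactSupport (𝓕 (fun x : ℝ => (φ₂ x : ℂ)))) :
    ∃ C : ℝ, ∀ R : ℝ, 16 ≤ R →
      ‖(4 : ℂ) * (∑' p : Nat.Primes,
            (((Real.log p) ^ 2 / (p * (Real.log R) ^ 2) : ℝ) : ℂ) *
              𝓕 (fun x : ℝ => (φ₁ x : ℂ)) (Real.log p / Real.log R) *
              𝓕 (fun x : ℝ => (φ₂ x : ℂ)) (Real.log p / Real.log R))
        - 2 * ∫ z : ℝ, ((|z| : ℝ) : ℂ) *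
              𝓕 (fun x : ℝ => (φ₁ x : ℂ)) z * 𝓕 (fun x : ℝ => (φ₂ x : ℂ)) z‖
        ≤ C * Real.log (Real.log R) / Real.log R := by
  obtain ⟨C, hC⟩ := exists_norm_tsum_primes_sub_integral_le
    ((contDiff_fourier_ofReal φ₁).mul (contDiff_fourier_ofReal φ₂))
    (fun x => by
      rw [fourier_neg_of_even (fun x => by rw [heven₁]),
        fourier_neg_of_even (fun x => by rw [heven₂])])
    hsupp₁.mul_right
  refine ⟨C, fun R hR => ?_⟩
  have hL : Real.exp 1 ≤ Real.log R := by
    refine le_trans ?_ (Real.log_le_log (by norm_num) hR)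
    rw [show (16 : ℝ) = 2 ^ 4 by norm_num, Real.log_pow]
    push_cast
    linarith [Real.exp_one_lt_d9, Real.log_two_gt_d9]
  have hL0 : 0 < Real.log R := (Real.exp_pos 1).trans_le hL
  have hLL : 1 ≤ Real.log (Real.log R) := (Real.le_log_iff_exp_le hL0).2 hL
  have h := hC (Real.log R) hL0
  have hC0 : 0 ≤ C := by
    have := (norm_nonneg _).trans h
    rwa [le_div_iff₀ hL0, zero_mul] at this
  simp only [mul_assoc] at h ⊢
  refine h.trans ?_
  gcongr
  exact le_mul_of_one_le_right hC0 hLL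
end
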